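/- Let p ≥ 5 be a prime and n ≥ 2. Then every elementary abelian p-subgroup of the iterated wreath product W(n) has rank at most p^{n−1}, and E(n) is the unique elementary abelian p-subgroup of W(n) of rank exactly p^{n−1}. (In particular the p-rank of W(n) is p^{n−1}, and E(n) is the unique maximal-rank p-torus of W(n).) -/

import Mathlib

/-- The shift automorphism of the direct power `ZMod p → H` by `k : ZMod p`. -/
def shiftAut (p : ℕ) (H : Type*) [Group H] (k : ZMod p) : MulAut (ZMod p → H) where
  toFun f := fun i => f (i + k)
  invFun f := fun i => f (i - k)
  left_inv f := by funext i; simp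
  right_inv f := by funext i; simp
  map_mul' f g := rfl

/-- The shift action of `ZMod p` on the direct power `ZMod p → H`. -/
def shiftHom (p : ℕ) (H : Type*) [Group H] :
    Multiplicative (ZMod p) →* MulAut (ZMod p → H) where
  toFun k := shiftAut p H k.toAdd
  map_one' := by
    ext f i
    show f (i + Multiplicative.toAdd 1) = f i
    simp
  map_mul' a b := by
    ext f i
    show f (i + Multiplicative.toAdd (a * b)) = f (i + Multiplicative.toAdd a + Multiplicative.toAdd b)
    rw [toAdd_mul, add_assoc]

/-- The wreath product `H ≀ ℤ/p`. -/
abbrev WreathZp (p : ℕ) (H : Type*) [Group H] : Type _ :=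
  SemidirectProduct (ZMod p → H) (Multiplicative (ZMod p)) (shiftHom p H)

/-- The inclusion of the base subgroup `H^p` into the wreath product. -/
abbrev wreathInl (p : ℕ) (H : Type*) [Group H] : (ZMod p → H) →* WreathZp p H :=
  SemidirectProduct.inl

/-- The base subgroup `H^p` of the wreath product, i.e. the elements with trivial
`ZMod p` component. -/
def wreathBase (p : ℕ) (H : Type*) [Group H] : Subgroup (WreathZp p H) :=
  (wreathInl p H).range

/-- `E` is an elementary abelian `p`-subgroup (a `p`-torus) of rank `r`, i.e. `E` is
isomorphic to `(ZMod p)^r`. -/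
def IsPTorus (p : ℕ) {G : Type*} [Group G] (E : Subgroup G) (r : ℕ) : Prop :=
  Nonempty (E ≃* (Fin r → Multiplicative (ZMod p)))

/-- The `p`-rank of a group: the maximal rank of an elementary abelian `p`-subgroup. -/
noncomputable def pRank (p : ℕ) (G : Type*) [Group G] : ℕ :=
  sSup {r | ∃ E : Subgroup G, IsPTorus p E r}


/-- A subgroup `H` of `G` is `i`-trivial if the centralizer of every elementary abelian
`p`-subgroup of rank at least `i` is contained in `H`. -/
def ITrivial (p : ℕ) {G : Type*} [Group G] (H : Subgroup G) (i : ℕ) : Prop :=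
  ∀ (E : Subgroup G) (r : ℕ), i ≤ r → IsPTorus p E r →
    Subgroup.centralizer (E : Set G) ≤ H

/-- For a subgroup `K ≤ H`, the subgroup `K^p = (ZMod p → K)` of the base subgroup of
the wreath product `H ≀ ℤ/p`. -/
def wreathBasePow (p : ℕ) {H : Type*} [Group H] (K : Subgroup H) :
    Subgroup (WreathZp p H) :=
  (Subgroup.pi (Set.univ : Set (ZMod p)) fun _ => K).map (wreathInl p H)

/-- Auxiliary bundled construction of the iterated wreath products. -/
def WAux (p : ℕ) : ℕ → Σ G : Type, Group G
  | 0 => ⟨Multiplicative (ZMod p), inferInstance⟩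
  | 1 => ⟨Multiplicative (ZMod p), inferInstance⟩
  | (n + 2) =>
      letI := (WAux p (n + 1)).2
      ⟨WreathZp p (WAux p (n + 1)).1, inferInstance⟩

/-- The iterated wreath product `W(n)`: `W(1) = ℤ/p` and `W(n) = W(n-1) ≀ ℤ/p`,
a Sylow `p`-subgroup of the symmetric group on `p^n` letters. -/
def W (p n : ℕ) : Type := (WAux p n).1

instance instGroupW (p n : ℕ) : Group (W p n) := (WAux p n).2

/-- The subgroup `E(n) ≤ W(n)`: `E(1) = W(1)` and `E(n) = E(n-1)^p`, the subgroup
`(ZMod p → E(n-1))` of the base subgroup of `W(n) = W(n-1) ≀ ℤ/p`. -/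
def EW (p : ℕ) : (n : ℕ) → Subgroup (W p n)
  | 0 => ⊤
  | 1 => ⊤
  | (n + 2) => wreathBasePow (H := W p (n + 1)) p (EW p (n + 1))


/-- Elementary abelian condition stated elementwise. -/
def ElemAb (p : ℕ) {G : Type*} [Group G] (A : Subgroup G) : Prop :=
  (∀ x ∈ A, ∀ y ∈ A, x * y = y * x) ∧ ∀ x ∈ A, x ^ p = 1

theorem ElemAb.map {p : ℕ} {G G' : Type*} [Group G] [Group G'] {A : Subgroup G}
    (h : ElemAb p A) (φ : G →* G') : ElemAb p (A.map φ) := by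
  constructor
  · rintro _ ⟨x, hx, rfl⟩ _ ⟨y, hy, rfl⟩
    rw [← map_mul, h.1 x hx y hy, map_mul]
  · rintro _ ⟨x, hx, rfl⟩
    rw [← map_pow, h.2 x hx, map_one]

theorem ElemAb.comap {p : ℕ} {G G' : Type*} [Group G] [Group G'] {A : Subgroup G'}
    (h : ElemAb p A) (φ : G →* G') (hφ : Function.Injective φ) : ElemAb p (A.comap φ) := by
  constructor
  · intro x hx y hy
    apply hφ
    rw [map_mul, map_mul, h.1 _ hx _ hy]
  · intro x hx
    apply hφ
    rw [map_pow, map_one, h.2 _ hx]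

theorem IsPTorus.elemAb {p : ℕ} {G : Type*} [Group G] {A : Subgroup G} {r : ℕ}
    (h : IsPTorus p A r) : ElemAb p A := by
  obtain ⟨e⟩ := h
  constructor
  · intro x hx y hy
    have : (⟨x, hx⟩ : A) * ⟨y, hy⟩ = ⟨y, hy⟩ * ⟨x, hx⟩ := by
      apply e.injective
      rw [map_mul, map_mul, mul_comm]
    exact congrArg Subtype.val this
  · intro x hx
    have : (⟨x, hx⟩ : A) ^ p = 1 := by
      apply e.injective
      rw [map_pow, map_one]
      funext i
      apply Multiplicative.toAdd.injective
      simp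
    exact congrArg Subtype.val this

theorem IsPTorus.card {p : ℕ} {G : Type*} [Group G] {A : Subgroup G} {r : ℕ}
    (h : IsPTorus p A r) : Nat.card A = p ^ r := by
  obtain ⟨e⟩ := h
  rw [Nat.card_congr e.toEquiv, Nat.card_fun]
  have : Nat.card (Multiplicative (ZMod p)) = p := Nat.card_zmod p
  simp [this]

/-- The base power of a torus is isomorphic to the direct power. -/
theorem basePow_torus {p : ℕ} [NeZero p] {H : Type*} [Group H] {K : Subgroup H} {r : ℕ}
    (h : IsPTorus p K r) : IsPTorus p (wreathBasePow p K) (r * p) := by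
  obtain ⟨e⟩ := h
  let e1 : (Subgroup.pi (Set.univ : Set (ZMod p)) fun _ => K) ≃* (ZMod p → K) :=
    { toFun := fun f i => ⟨f.1 i, f.2 i (Set.mem_univ i)⟩
      invFun := fun f => ⟨fun i => (f i).1, fun i _ => (f i).2⟩
      left_inv := fun f => rfl
      right_inv := fun f => rfl
      map_mul' := fun f g => rfl }
  let e2 : (ZMod p → K) ≃* (ZMod p → Fin r → Multiplicative (ZMod p)) :=
    MulEquiv.piCongrRight fun _ => e
  let c : Fin (r * p) ≃ ZMod p × Fin r :=
    Fintype.equivOfCardEq (by simp [ZMod.card, mul_comm])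
  let e3 : (ZMod p → Fin r → Multiplicative (ZMod p)) ≃*
      (Fin (r * p) → Multiplicative (ZMod p)) :=
    { toFun := fun f i => f (c i).1 (c i).2
      invFun := fun g a b => g (c.symm (a, b))
      left_inv := fun f => by funext a b; simp
      right_inv := fun g => by funext i; simp
      map_mul' := fun f g => rfl }
  exact ⟨((Subgroup.equivMapOfInjective _ (wreathInl p H)
    SemidirectProduct.inl_injective).symm.trans e1).trans (e2.trans e3)⟩

theorem base_bound {p : ℕ} [NeZero p] {H : Type*} [Group H] [Finite H] {K : Subgroup H} {N : ℕ}
    (hN : 0 < N) (hcard : Nat.card K = N)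
    (hK : ∀ A : Subgroup H, ElemAb p A → Nat.card A ≤ N ∧ (Nat.card A = N → A = K))
    (B : Subgroup (ZMod p → H)) (hB : ElemAb p B) :
    Nat.card B ≤ N ^ p ∧
      (Nat.card B = N ^ p → B = Subgroup.pi (Set.univ : Set (ZMod p)) fun _ => K) := by
  have hBi : ∀ i, ElemAb p (B.map (Pi.evalMonoidHom (fun _ => H) i)) := fun i => hB.map _
  have hle : Nat.card B ≤ ∏ i, Nat.card (B.map (Pi.evalMonoidHom (fun _ : ZMod p => H) i)) := by
    rw [← Nat.card_pi]
    refine Nat.card_le_card_of_injective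
      (fun b i => (⟨b.1 i, ⟨b.1, b.2, rfl⟩⟩ : B.map (Pi.evalMonoidHom (fun _ : ZMod p => H) i))) ?_
    intro a b hab
    apply Subtype.ext
    funext i
    exact congrArg Subtype.val (congrFun hab i)
  have hprod : ∏ _i : ZMod p, N = N ^ p := by simp [ZMod.card]
  refine ⟨hle.trans ?_, ?_⟩
  · rw [← hprod]
    exact Finset.prod_le_prod' fun i _ => (hK _ (hBi i)).1
  · intro heq
    have hall : ∀ i, Nat.card (B.map (Pi.evalMonoidHom (fun _ : ZMod p => H) i)) = N := by
      by_contra! hne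
      obtain ⟨i, hi⟩ := hne
      have hlt := Finset.prod_lt_prod (s := Finset.univ)
        (f := fun i => Nat.card (B.map (Pi.evalMonoidHom (fun _ : ZMod p => H) i)))
        (g := fun _ => N) (fun i _ => Nat.card_pos) (fun i _ => (hK _ (hBi i)).1)
        ⟨i, Finset.mem_univ i, lt_of_le_of_ne (hK _ (hBi i)).1 hi⟩
      rw [hprod] at hlt
      omega
    have hBK : B ≤ Subgroup.pi (Set.univ : Set (ZMod p)) fun _ => K := by
      intro b hb i _
      have : b i ∈ B.map (Pi.evalMonoidHom (fun _ : ZMod p => H) i) := ⟨b, hb, rfl⟩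
      rwa [(hK _ (hBi i)).2 (hall i)] at this
    apply Subgroup.eq_of_le_of_card_ge hBK
    rw [heq, ← hprod, ← hcard, ← Nat.card_pi]
    refine Nat.card_le_card_of_injective
      (fun b i => (⟨b.1 i, b.2 i (Set.mem_univ i)⟩ : K)) ?_
    intro a b hab
    apply Subtype.ext
    funext i
    exact congrArg Subtype.val (congrFun hab i)

theorem offbase_bound {p : ℕ} [Fact p.Prime] {H : Type*} [Group H] [Finite H] {N : ℕ}
    (hK : ∀ A : Subgroup H, ElemAb p A → Nat.card A ≤ N)
    (A : Subgroup (WreathZp p H)) (hA : ElemAb p A) (a : WreathZp p H) (ha : a ∈ A)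
    (hr : a.right ≠ 1) : Nat.card A ≤ N * p := by
  let φ : A →* Multiplicative (ZMod p) := SemidirectProduct.rightHom.comp A.subtype
  have h1 := φ.ker.card_mul_index
  rw [Subgroup.index_ker] at h1
  have h2 : Nat.card φ.range ≤ p := by
    refine (Nat.card_le_card_of_injective _ φ.range.subtype_injective).trans ?_
    exact (Nat.card_zmod p).le
  let B := A.comap (wreathInl p H)
  have hB : ElemAb p B := hA.comap _ SemidirectProduct.inl_injective
  have h3 : Nat.card φ.ker ≤ N := by
    refine le_trans ?_ (hK _ (hB.map (Pi.evalMonoidHom (fun _ : ZMod p => H) 0)))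
    have hmem : ∀ x : φ.ker, x.1.1.left ∈ B := by
      intro x
      have hx : x.1.1.right = 1 := x.2
      show SemidirectProduct.inl x.1.1.left ∈ A
      have : SemidirectProduct.inl x.1.1.left = x.1.1 := by
        ext1
        · simp
        · simp [hx]
      rw [this]
      exact x.1.2
    refine Nat.card_le_card_of_injective (fun x => (⟨x.1.1.left 0, ⟨x.1.1.left, hmem x, rfl⟩⟩ :
      B.map (Pi.evalMonoidHom (fun _ : ZMod p => H) 0))) ?_
    intro x y hxy
    have h0 : x.1.1.left 0 = y.1.1.left 0 := congrArg Subtype.val hxy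
    have hx : x.1.1.right = 1 := x.2
    have hy : y.1.1.right = 1 := y.2
    set k : ZMod p := a.right.toAdd with hk
    have hk0 : k ≠ 0 := fun h => hr (Multiplicative.toAdd.injective h)
    have key : ∀ z : φ.ker, ∀ i, a.left i * z.1.1.left (i + k) = z.1.1.left i * a.left i := by
      intro z i
      have hz : z.1.1.right = 1 := z.2
      have hc := congrArg SemidirectProduct.left (hA.1 a ha z.1.1 z.1.2)
      rw [SemidirectProduct.mul_left, SemidirectProduct.mul_left, hz, map_one] at hc
      exact congrFun hc i
    have hn : ∀ n : ℕ, x.1.1.left (n * k) = y.1.1.left (n * k) := by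
      intro n
      induction n with
      | zero => simpa using h0
      | succ n ih =>
        have e1 := key x (n * k)
        have e2 := key y (n * k)
        rw [ih, ← e2] at e1
        have := mul_left_cancel e1
        rwa [show ((n + 1 : ℕ) : ZMod p) * k = n * k + k by push_cast; ring]
    apply Subtype.ext
    apply Subtype.ext
    ext1
    · funext i
      have := hn (i / k).val
      rwa [ZMod.natCast_zmod_val, div_mul_cancel₀ _ hk0] at this
    · rw [hx, hy]
  rw [← h1]
  exact Nat.mul_le_mul h3 h2

theorem wreath_step {p : ℕ} [Fact p.Prime] (hp3 : 3 ≤ p) {H : Type*} [Group H] [Finite H]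
    {K : Subgroup H} {m : ℕ} (hm : 1 ≤ m) (hcard : Nat.card K = p ^ m)
    (hK : ∀ A : Subgroup H, ElemAb p A → Nat.card A ≤ p ^ m ∧ (Nat.card A = p ^ m → A = K))
    (A : Subgroup (WreathZp p H)) (hA : ElemAb p A) :
    Nat.card A ≤ p ^ (m * p) ∧ (Nat.card A = p ^ (m * p) → A = wreathBasePow p K) := by
  by_cases hb : ∀ a ∈ A, a.right = 1
  · have hAB : A = (A.comap (wreathInl p H)).map (wreathInl p H) := by
      rw [Subgroup.map_comap_eq, eq_comm, inf_eq_right]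
      intro a ha
      refine ⟨a.left, ?_⟩
      ext1
      · simp
      · simp [hb a ha]
    have hc : Nat.card (A.comap (wreathInl p H)) = Nat.card A := by
      conv_rhs => rw [hAB]
      exact Nat.card_congr (Subgroup.equivMapOfInjective _ (wreathInl p H)
        SemidirectProduct.inl_injective).toEquiv
    have := base_bound (pow_pos (by omega) m) hcard hK _
      (hA.comap (wreathInl p H) SemidirectProduct.inl_injective)
    rw [hc, ← pow_mul] at this
    refine ⟨this.1, fun h => ?_⟩
    rw [hAB, this.2 h]
    rfl
  · push Not at hb
    obtain ⟨a, ha, hr⟩ := hb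
    have h1 := offbase_bound (fun A hA => (hK A hA).1) A hA a ha hr
    have h2 : p ^ m * p < p ^ (m * p) := by
      rw [← pow_succ]
      apply Nat.pow_lt_pow_right (by omega)
      nlinarith
    exact ⟨by omega, fun h => by omega⟩

theorem W_main (p : ℕ) [Fact p.Prime] (hp3 : 3 ≤ p) (n : ℕ) :
    Finite (W p (n + 1)) ∧ IsPTorus p (EW p (n + 1)) (p ^ n) ∧
    ∀ A : Subgroup (W p (n + 1)), ElemAb p A →
      Nat.card A ≤ p ^ (p ^ n) ∧ (Nat.card A = p ^ (p ^ n) → A = EW p (n + 1)) := by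
  induction n with
  | zero =>
    have hf : Finite (W p (0 + 1)) := inferInstanceAs (Finite (ZMod p))
    have hc : Nat.card (W p (0 + 1)) = p := Nat.card_zmod p
    refine ⟨hf, ?_, ?_⟩
    · rw [pow_zero]
      exact ⟨(Subgroup.topEquiv (G := Multiplicative (ZMod p))).trans
        (MulEquiv.funUnique (Fin 1) (Multiplicative (ZMod p))).symm⟩
    · intro A _
      rw [pow_zero, pow_one]
      refine ⟨?_, fun h => ?_⟩
      · exact (Nat.card_le_card_of_injective _ A.subtype_injective).trans hc.le
      · exact Subgroup.eq_top_of_card_eq A (h.trans hc.symm)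
  | succ n ih =>
    obtain ⟨hf, ht, hA⟩ := ih
    refine ⟨?_, ?_, ?_⟩
    · exact Finite.of_equiv _ (SemidirectProduct.equivProd (φ := shiftHom p (W p (n + 1)))).symm
    · rw [pow_succ]
      exact basePow_torus (H := W p (n + 1)) ht
    · rw [pow_succ p n]
      exact wreath_step (H := W p (n + 1)) hp3 (Nat.one_le_pow _ _ (by omega)) ht.card hA

/-- for `p ≥ 5` prime and `n ≥ 2`, every elementary abelian `p`-subgroup of
`W(n)` has rank at most `p^(n-1)`, and `E(n)` is the unique elementary abelian
`p`-subgroup of `W(n)` of rank exactly `p^(n-1)`. -/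
theorem stmt8 (p n : ℕ) (hp : p.Prime) (hp5 : 5 ≤ p) (hn : 2 ≤ n) :
    (∀ (A : Subgroup (W p n)) (r : ℕ), IsPTorus p A r → r ≤ p ^ (n - 1)) ∧
    IsPTorus p (EW p n) (p ^ (n - 1)) ∧
    ∀ A : Subgroup (W p n), IsPTorus p A (p ^ (n - 1)) → A = EW p n := by
  haveI : Fact p.Prime := ⟨hp⟩
  obtain ⟨m, rfl⟩ : ∃ m, n = m + 1 := ⟨n - 1, by omega⟩
  obtain ⟨_, ht, hA⟩ := W_main p (by omega) m
  rw [Nat.add_sub_cancel]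
  refine ⟨fun A r h => ?_, ht, fun A h => (hA A h.elemAb).2 h.card⟩
  have h1 := (hA A h.elemAb).1
  rw [h.card] at h1
  exact (Nat.pow_le_pow_iff_right (by omega)).1 h1
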